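/- (a) If t ↦ L ∘ T₀(t) is norm continuous on (0,∞), then ℓ^∞_{R₀}(X₀) = ℓ^∞_{T₀}(X₀), the induced quotient operators R̂₀(t) and T̂₀(t) are defined, and ω_crit(R₀) = ω_crit(T₀). (b) If t ↦ L ∘ T₀(t) is norm continuous on (0,∞) and L ∘ T₀(t) is a compact operator for every t > 0, then ω_ess(R₀) = ω_ess(T₀). -/

import Mathlib

open Set Filter MeasureTheory
open scoped Topology

noncomputable section

structure MRSetting (X : Type*) [NormedAddCommGroup X] [NormedSpace ℂ X] [CompleteSpace X]
    (X₀ : Submodule ℂ X) where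
  closed : IsClosed (X₀ : Set X)
  T : ℝ → (X₀ →L[ℂ] X₀)
  S : ℝ → (X →L[ℂ] X₀)
  T_zero : T 0 = 1
  T_add : ∀ t s : ℝ, 0 ≤ t → 0 ≤ s → T (t + s) = (T t).comp (T s)
  T_cont : ∀ x : X₀, ContinuousOn (fun t => T t x) (Ici 0)
  S_zero : S 0 = 0
  S_cont : ∀ x : X, ContinuousOn (fun t => S t x) (Ici 0)
  TS : ∀ t s : ℝ, 0 ≤ t → 0 ≤ s → ∀ x : X, T t (S s x) = S (t + s) x - S t x
  δ : ℝ → ℝ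
  δ_nonneg : ∀ t : ℝ, 0 ≤ t → 0 ≤ δ t
  δ_mono : MonotoneOn δ (Ici 0)
  δ_lim : Tendsto δ (𝓝[>] 0) (𝓝 0)
  SD : (ℝ → X) → ℝ → X₀
  SD_deriv : ∀ f : ℝ → X, ContinuousOn f (Ici 0) → ∀ t ∈ Ici (0:ℝ),
    HasDerivWithinAt (fun τ : ℝ => ∫ s in (0:ℝ)..τ, S (τ - s) (f s)) (SD f t) (Ici 0) t
  SD_cont : ∀ f : ℝ → X, ContinuousOn f (Ici 0) → ContinuousOn (SD f) (Ici 0)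
  SD_bound : ∀ f : ℝ → X, ContinuousOn f (Ici 0) → ∀ t ∈ Ici (0:ℝ),
    ‖SD f t‖ ≤ δ t * ⨆ s : Icc (0:ℝ) t, ‖f (s : ℝ)‖
  SDop : (ℝ → (X₀ →L[ℂ] X)) → ℝ → (X₀ →L[ℂ] X₀)
  SDop_apply : ∀ V : ℝ → (X₀ →L[ℂ] X), (∀ x : X₀, ContinuousOn (fun s => V s x) (Ici 0)) →
    ∀ t : ℝ, ∀ x : X₀, SDop V t x = SD (fun s => V s x) t

variable {X : Type*} [NormedAddCommGroup X] [NormedSpace ℂ X] [CompleteSpace X]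
  {X₀ : Submodule ℂ X}

/-- The perturbation operator `B(U) = S ⋄ (L ∘ U)`. -/
def MRSetting.Bop (M : MRSetting X X₀) (L : X₀ →L[ℂ] X) (U : ℝ → (X₀ →L[ℂ] X₀)) :
    ℝ → (X₀ →L[ℂ] X₀) :=
  M.SDop (fun s => L.comp (U s))


/-- The essential growth bound of an operator family `W`, defined through the operator-norm
distance from `W t` to the compact operators. -/
def omegaEss (W : ℝ → (X₀ →L[ℂ] X₀)) : EReal :=
  sInf ((fun w : ℝ => (w : EReal)) ''
    {w : ℝ | ∃ C : ℝ, 0 ≤ C ∧ ∀ t : ℝ, 0 ≤ t →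
      Metric.infDist (W t) {K : X₀ →L[ℂ] X₀ | IsCompactOperator ⇑K} ≤ C * Real.exp (w * t)})

/-- The operator induced on `ℓ^∞(X₀)` (bounded sequences in `X₀`) by coordinatewise
application of a bounded operator. -/
def seqOp (W : X₀ →L[ℂ] X₀) :
    BoundedContinuousFunction ℕ X₀ →L[ℂ] BoundedContinuousFunction ℕ X₀ :=
  W.compLeftContinuousBounded ℕ

/-- The subspace `ℓ^∞_W(X₀)` of strong continuity of the extension of `W` to `ℓ^∞(X₀)`:
those bounded sequences `x` with `sup_n ‖W(t) xₙ − xₙ‖ → 0` as `t → 0⁺`. -/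
def critSub (W : ℝ → (X₀ →L[ℂ] X₀)) : Submodule ℂ (BoundedContinuousFunction ℕ X₀) where
  carrier := {x | Tendsto (fun t : ℝ => seqOp (W t) x) (𝓝[>] 0) (𝓝 x)}
  add_mem' := by
    intro a b ha hb
    simp only [Set.mem_setOf_eq, map_add] at ha hb ⊢
    exact Tendsto.add ha hb
  zero_mem' := by
    simp only [Set.mem_setOf_eq, map_zero]
    exact tendsto_const_nhds
  smul_mem' := by
    intro c x hx
    simp only [Set.mem_setOf_eq, _root_.map_smul] at hx ⊢
    exact Tendsto.const_smul hx c

/-- The critical growth bound of an operator family `W`: the growth bound of the operators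
induced by `W` on the quotient `ℓ^∞(X₀)/ℓ^∞_W(X₀)`, expressed via the quotient norm
`‖[x]‖ = infDist x ℓ^∞_W(X₀)`. -/
def omegaCrit (W : ℝ → (X₀ →L[ℂ] X₀)) : EReal :=
  sInf ((fun w : ℝ => (w : EReal)) ''
    {w : ℝ | ∃ C : ℝ, 0 ≤ C ∧ ∀ t : ℝ, 0 ≤ t → ∀ x : BoundedContinuousFunction ℕ X₀,
      Metric.infDist (seqOp (W t) x) (critSub W : Set (BoundedContinuousFunction ℕ X₀)) ≤
        C * Real.exp (w * t) *
          Metric.infDist x (critSub W : Set (BoundedContinuousFunction ℕ X₀))})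


/-! ### Helper lemmas -/

/-- Strong continuity on `[0,∞)`. -/
def SCont {E F : Type*} [NormedAddCommGroup E] [NormedSpace ℂ E] [NormedAddCommGroup F]
    [NormedSpace ℂ F] (V : ℝ → (E →L[ℂ] F)) : Prop :=
  ∀ x : E, ContinuousOn (fun s => V s x) (Ici 0)

section generic

variable {E F G : Type*} [NormedAddCommGroup E] [NormedSpace ℂ E] [NormedAddCommGroup F]
    [NormedSpace ℂ F] [NormedAddCommGroup G] [NormedSpace ℂ G]

theorem SCont.bdd [CompleteSpace E] {V : ℝ → (E →L[ℂ] F)} (hV : SCont V) (b : ℝ) :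
    ∃ C : ℝ, 1 ≤ C ∧ ∀ t ∈ Icc (0:ℝ) b, ‖V t‖ ≤ C := by
  obtain ⟨C, hC⟩ := banach_steinhaus (g := fun t : Icc (0:ℝ) b => V t) (by
    intro x
    have h1 : ContinuousOn (fun s => V s x) (Icc 0 b) := (hV x).mono Icc_subset_Ici_self
    obtain ⟨C, hC⟩ := isCompact_Icc.exists_bound_of_continuousOn h1
    exact ⟨C, fun i => hC i i.2⟩)
  exact ⟨max C 1, le_max_right _ _, fun t ht => (hC ⟨t, ht⟩).trans (le_max_left _ _)⟩

theorem SCont.clm_comp {V : ℝ → (E →L[ℂ] F)} (hV : SCont V) (L : F →L[ℂ] G) :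
    SCont (fun s => L.comp (V s)) := fun x => L.continuous.comp_continuousOn (hV x)

theorem SCont.comp_clm {V : ℝ → (F →L[ℂ] G)} (hV : SCont V) (L : E →L[ℂ] F) :
    SCont (fun s => (V s).comp L) := fun x => hV (L x)

theorem SCont.shift {V : ℝ → (E →L[ℂ] F)} (hV : SCont V) {h : ℝ} (hh : 0 ≤ h) :
    SCont (fun s => V (h + s)) := fun x =>
  (hV x).comp (by fun_prop) (fun s hs => add_nonneg hh hs)

theorem SCont.add {V W : ℝ → (E →L[ℂ] F)} (hV : SCont V) (hW : SCont W) :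
    SCont (fun s => V s + W s) := fun x => (hV x).add (hW x)

theorem SCont.sub {V W : ℝ → (E →L[ℂ] F)} (hV : SCont V) (hW : SCont W) :
    SCont (fun s => V s - W s) := fun x => (hV x).sub (hW x)

theorem SCont.apply [CompleteSpace E] {V : ℝ → (E →L[ℂ] F)} (hV : SCont V) {s : Set ℝ}
    {g : ℝ → ℝ} {f : ℝ → E} (hg : ContinuousOn g s) (hgs : MapsTo g s (Ici 0))
    (hf : ContinuousOn f s) : ContinuousOn (fun r => V (g r) (f r)) s := by
  intro p hp
  obtain ⟨C, hC1, hC⟩ := hV.bdd (g p + 1)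
  have h1 : Tendsto (fun r => V (g r) (f p)) (𝓝[s] p) (𝓝 (V (g p) (f p))) :=
    ((hV (f p)).comp hg hgs) p hp
  have h2 : Tendsto (fun r => V (g r) (f r - f p)) (𝓝[s] p) (𝓝 0) := by
    have h3 : Tendsto (fun r => C * ‖f r - f p‖) (𝓝[s] p) (𝓝 0) := by
      have : Tendsto (fun r => f r - f p) (𝓝[s] p) (𝓝 (f p - f p)) := (hf p hp).sub_const _
      simpa using this.norm.const_mul C
    refine squeeze_zero_norm' ?_ h3
    have h4 : ∀ᶠ r in 𝓝[s] p, g r < g p + 1 := (hg p hp).eventually_lt_const (by linarith)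
    filter_upwards [h4, self_mem_nhdsWithin] with r hr hrs
    exact (V (g r)).le_of_opNorm_le (hC _ ⟨hgs hrs, hr.le⟩) _
  have := h2.add h1
  simpa [ContinuousWithinAt] using this

/-- Uniform right norm continuity on compact subsets of `(0,∞)`. -/
def NCont (V : ℝ → (E →L[ℂ] F)) : Prop :=
  ∀ a b η : ℝ, 0 < a → 0 < η → ∃ h₀ > 0, ∀ h ∈ Icc (0:ℝ) h₀, ∀ t ∈ Icc a b,
    ‖V (h + t) - V t‖ ≤ η

theorem NCont.of_continuousOn {V : ℝ → (E →L[ℂ] F)} (hV : ContinuousOn V (Ioi 0)) :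
    NCont V := by
  intro a b η ha hη
  have h1 : UniformContinuousOn V (Icc a (b+1)) :=
    isCompact_Icc.uniformContinuousOn_of_continuous
      (hV.mono (fun x hx => lt_of_lt_of_le ha hx.1))
  rw [Metric.uniformContinuousOn_iff] at h1
  obtain ⟨d, hd, h2⟩ := h1 η hη
  refine ⟨min (d/2) 1, by positivity, ?_⟩
  intro h hh t ht
  have h3 : h ≤ d/2 := hh.2.trans (min_le_left _ _)
  have h4 : h ≤ 1 := hh.2.trans (min_le_right _ _)
  have := h2 (h+t) ⟨by linarith [hh.1, ht.1], by linarith [ht.2]⟩ t ⟨ht.1, by linarith [ht.2]⟩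
    (by rw [Real.dist_eq]; simp [abs_of_nonneg hh.1]; linarith)
  rw [dist_eq_norm] at this
  exact this.le

theorem NCont.continuousOn {V : ℝ → (E →L[ℂ] F)} (hV : NCont V) : ContinuousOn V (Ioi 0) := by
  intro p hp
  have hp : 0 < p := hp
  rw [Metric.continuousWithinAt_iff]
  intro ε hε
  obtain ⟨h₀, hh₀, h1⟩ := hV (p/2) (p+1) (ε/2) (by linarith) (by linarith)
  refine ⟨min h₀ (min (p/2) 1), by positivity, ?_⟩
  intro x hx hd
  rw [Real.dist_eq] at hd
  have hd1 := hd.trans_le (min_le_left _ _)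
  have hd2 := hd.trans_le ((min_le_right _ _).trans (min_le_left _ _))
  have hd3 := hd.trans_le ((min_le_right _ _).trans (min_le_right _ _))
  rw [abs_lt] at hd1 hd2 hd3
  rcases le_total p x with h | h
  · have := h1 (x - p) ⟨by linarith, by linarith⟩ p ⟨by linarith, by linarith⟩
    rw [sub_add_cancel] at this
    rw [dist_eq_norm]; linarith
  · have := h1 (p - x) ⟨by linarith, by linarith⟩ x ⟨by linarith, by linarith⟩
    rw [sub_add_cancel] at this
    rw [dist_comm, dist_eq_norm]; linarith

theorem NCont.add {V W : ℝ → (E →L[ℂ] F)} (hV : NCont V) (hW : NCont W) :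
    NCont (fun s => V s + W s) :=
  NCont.of_continuousOn (hV.continuousOn.add hW.continuousOn)

theorem NCont.clm_comp {V : ℝ → (E →L[ℂ] F)} (hV : NCont V) (L : F →L[ℂ] G) :
    NCont (fun s => L.comp (V s)) :=
  NCont.of_continuousOn (continuousOn_const.clm_comp hV.continuousOn)

theorem infDist_add_mem {E : Type*} [NormedAddCommGroup E] (s : Set E) (hs0 : ∀ a ∈ s, ∀ b ∈ s, a + b ∈ s) (hs1 : ∀ a ∈ s, -a ∈ s)
    (x k : E) (hk : k ∈ s) : Metric.infDist (x + k) s = Metric.infDist x s := by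
  have h1 : (fun y : E => y + k) '' s = s := by
    ext y
    constructor
    · rintro ⟨z, hz, rfl⟩
      exact hs0 _ hz _ hk
    · intro hy
      exact ⟨y + -k, hs0 _ hy _ (hs1 _ hk), by simp⟩
  have h2 : Isometry (fun y : E => y + k) := isometry_add_right k
  have := Metric.infDist_image h2 (x := x) (t := s)
  rwa [h1] at this

theorem mem_closed_of_norm {P : Set E} (hP : IsClosed P) {x : E}
    (h : ∀ ε > 0, ∃ y ∈ P, ‖x - y‖ < ε) : x ∈ P := by
  refine hP.closure_subset (Metric.mem_closure_iff.2 ?_)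
  simpa only [dist_eq_norm] using h

theorem tendsto_norm_iff {f : ℝ → E} {l : Filter ℝ} {x : E} :
    Tendsto f l (𝓝 x) ↔ ∀ ε > 0, ∀ᶠ h in l, ‖f h - x‖ < ε := by
  simp only [Metric.tendsto_nhds, dist_eq_norm]

theorem bernstein_approx {f : unitInterval → E} (hf : Continuous f) {ε : ℝ} (hε : 0 < ε) :
    ∃ n : ℕ, ∀ u, ‖f u - ∑ k : Fin (n + 1), ((bernstein n k u : ℝ) : ℂ) • f (bernstein.z k)‖ ≤ ε := by
  obtain ⟨n, hn⟩ := Metric.tendsto_atTop.1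
    (bernsteinApproximation_uniform (⟨f, hf⟩ : C(unitInterval, E))) ε hε
  refine ⟨n, fun u => ?_⟩
  have h1 := (ContinuousMap.dist_apply_le_dist (f := bernsteinApproximation n ⟨f, hf⟩)
    (g := ⟨f, hf⟩) u).trans (hn n le_rfl).le
  rw [dist_comm, dist_eq_norm, bernsteinApproximation.apply] at h1
  exact h1

end generic

namespace MRSetting

variable (M : MRSetting X X₀)

theorem complete (M : MRSetting X X₀) : CompleteSpace X₀ := M.closed.isComplete.completeSpace_coe

theorem δ_zero : M.δ 0 = 0 := by
  have h1 : M.δ 0 ≤ 0 := by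
    refine ge_of_tendsto M.δ_lim ?_
    filter_upwards [self_mem_nhdsWithin] with t ht
    have ht : (0:ℝ) < t := ht
    exact M.δ_mono self_mem_Ici (mem_Ici.2 ht.le) ht.le
  exact le_antisymm h1 (M.δ_nonneg 0 le_rfl)

theorem exists_δ_le {η a : ℝ} (hη : 0 < η) (ha : 0 < a) : ∃ τ > 0, τ ≤ a ∧ M.δ τ ≤ η := by
  have h1 : ∀ᶠ t in 𝓝[>] (0:ℝ), M.δ t < η := M.δ_lim.eventually_lt_const hη
  have h2 : ∀ᶠ t in 𝓝[>] (0:ℝ), t ∈ Ioc 0 a := Ioc_mem_nhdsGT ha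
  obtain ⟨t, h3, h4⟩ := (h1.and h2).exists
  exact ⟨t, h4.1, h4.2, h3.le⟩

theorem SD_le {f : ℝ → X} (hf : ContinuousOn f (Ici 0)) {t C : ℝ} (ht : 0 ≤ t)
    (hC : ∀ s ∈ Icc (0:ℝ) t, ‖f s‖ ≤ C) : ‖M.SD f t‖ ≤ M.δ t * C := by
  refine (M.SD_bound f hf t ht).trans ?_
  refine mul_le_mul_of_nonneg_left ?_ (M.δ_nonneg t ht)
  have : Nonempty (Icc (0:ℝ) t) := ⟨⟨0, le_rfl, ht⟩⟩
  exact ciSup_le fun s => hC s s.2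

theorem SD_zero {f : ℝ → X} (hf : ContinuousOn f (Ici 0)) : M.SD f 0 = 0 := by
  have := M.SD_le hf (t := 0) (C := ‖f 0‖) le_rfl (by
    intro s hs
    have : s = 0 := le_antisymm hs.2 hs.1
    rw [this])
  rw [M.δ_zero, zero_mul] at this
  simpa using this

theorem integrand_cont {f : ℝ → X} (hf : ContinuousOn f (Ici 0)) {a b c : ℝ} (ha : 0 ≤ a)
    (hbc : b ≤ c) :
    ContinuousOn (fun s => M.S (c - s) (f s)) (Icc a b) := by
  have hS : SCont M.S := M.S_cont
  refine hS.apply (by fun_prop) ?_ (hf.mono ?_)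
  · intro s hs
    have := hs.2
    simp; linarith
  · intro s hs
    exact ha.trans hs.1

theorem integrand_int {f : ℝ → X} (hf : ContinuousOn f (Ici 0)) {a b c : ℝ} (ha : 0 ≤ a)
    (hab : a ≤ b) (hbc : b ≤ c) :
    IntervalIntegrable (fun s => M.S (c - s) (f s)) volume a b := by
  apply ContinuousOn.intervalIntegrable
  rw [uIcc_of_le hab]
  exact M.integrand_cont hf ha hbc

theorem SD_unique {f : ℝ → X} {t : ℝ} (ht : 0 ≤ t) {y : X₀} (hf : ContinuousOn f (Ici 0))
    (h : HasDerivWithinAt (fun τ : ℝ => ∫ s in (0:ℝ)..τ, M.S (τ - s) (f s)) y (Ici 0) t) :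
    M.SD f t = y :=
  (uniqueDiffOn_Ici (0:ℝ) t ht).eq_deriv _ (M.SD_deriv f hf t ht) h

theorem SD_add {f g : ℝ → X} (hf : ContinuousOn f (Ici 0)) (hg : ContinuousOn g (Ici 0)) {t : ℝ}
    (ht : 0 ≤ t) : M.SD (fun s => f s + g s) t = M.SD f t + M.SD g t := by
  have := M.complete
  refine M.SD_unique ht (hf.add hg) ?_
  refine ((M.SD_deriv f hf t ht).add (M.SD_deriv g hg t ht)).congr_of_mem ?_ ht
  intro τ hτ
  have := intervalIntegral.integral_add (M.integrand_int hf le_rfl hτ le_rfl)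
    (M.integrand_int hg le_rfl hτ le_rfl)
  simp only [map_add]
  exact this

theorem SD_smul {f : ℝ → X} (hf : ContinuousOn f (Ici 0)) (c : ℂ) {t : ℝ}
    (ht : 0 ≤ t) : M.SD (fun s => c • f s) t = c • M.SD f t := by
  have := M.complete
  refine M.SD_unique ht (hf.const_smul c) ?_
  refine ((M.SD_deriv f hf t ht).const_smul c).congr_of_mem ?_ ht
  intro τ hτ
  simp only [map_smul]
  exact intervalIntegral.integral_smul c _

theorem SD_sub {f g : ℝ → X} (hf : ContinuousOn f (Ici 0)) (hg : ContinuousOn g (Ici 0)) {t : ℝ}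
    (ht : 0 ≤ t) : M.SD (fun s => f s - g s) t = M.SD f t - M.SD g t := by
  have h1 := M.SD_add (g := fun s => (-1 : ℂ) • g s) hf (hg.const_smul (-1 : ℂ)) ht
  have h2 := M.SD_smul hg (-1 : ℂ) ht
  simp only [neg_smul, one_smul] at h1 h2
  rw [h2] at h1
  simpa [sub_eq_add_neg] using h1

theorem SD_shift {f : ℝ → X} (hf : ContinuousOn f (Ici 0)) {t h : ℝ} (ht : 0 ≤ t) (hh : 0 ≤ h) :
    M.SD f (h + t) = M.T t (M.SD f h) + M.SD (fun s => f (h + s)) t := by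
  have := M.complete
  have hfh : ContinuousOn (fun s => f (h + s)) (Ici 0) :=
    hf.comp (by fun_prop) (fun s hs => add_nonneg hh hs)
  let Φ : (ℝ → X) → ℝ → X₀ := fun f τ => ∫ s in (0:ℝ)..τ, M.S (τ - s) (f s)
  let G : ℝ → X₀ := fun r => Φ f (h + r) - Φ (fun s => f (h + s)) r
  have hG : ∀ r, 0 ≤ r → G r = ∫ s in (0:ℝ)..h, M.S (h + r - s) (f s) := by
    intro r hr
    have h1 := intervalIntegral.integral_add_adjacent_intervals
      (M.integrand_int hf le_rfl hh (show h ≤ h + r by linarith))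
      (M.integrand_int hf hh (show h ≤ h + r by linarith) le_rfl)
    have h2 : Φ (fun s => f (h + s)) r = ∫ s in h..(h+r), M.S (h + r - s) (f s) := by
      have := intervalIntegral.integral_comp_add_left (a := 0) (b := r)
        (fun s => M.S (h + r - s) (f s)) h
      simp only [add_zero] at this
      rw [← this]
      simp only [Φ, add_sub_add_left_eq_sub]
    simp only [G]
    rw [h2]
    exact sub_eq_iff_eq_add.2 h1.symm
  have hder : ∀ r, 0 ≤ r →
      HasDerivWithinAt G (M.SD f (h + r) - M.SD (fun s => f (h + s)) r) (Ici 0) r := by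
    intro r hr
    have h1 := M.SD_deriv f hf (h + r) (add_nonneg hh hr)
    have h2 : HasDerivWithinAt (fun u : ℝ => h + u) 1 (Ici 0) r :=
      (hasDerivWithinAt_id r _).const_add h
    have h3 := HasDerivWithinAt.scomp r h1 h2 (fun s hs => add_nonneg hh hs)
    rw [one_smul] at h3
    exact h3.sub (M.SD_deriv _ hfh r hr)
  have hGG : ∀ r, 0 ≤ r → G (t + r) = G t + M.T t (G r - G 0) := by
    intro r hr
    have i1 : ∀ u, 0 ≤ u → IntervalIntegrable (fun s => M.S (h + u - s) (f s)) volume 0 h :=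
      fun u hu => M.integrand_int hf le_rfl hh (by linarith)
    rw [hG _ (add_nonneg ht hr), hG _ ht, hG _ hr, hG 0 le_rfl,
      ← intervalIntegral.integral_sub (i1 r hr) (i1 0 le_rfl)]
    have i2 := (i1 r hr).sub (i1 0 le_rfl)
    have h3 : M.T t (∫ s in (0:ℝ)..h, (M.S (h + r - s) (f s) - M.S (h + 0 - s) (f s)))
        = ∫ s in (0:ℝ)..h, M.T t (M.S (h + r - s) (f s) - M.S (h + 0 - s) (f s)) :=
      ((M.T t).intervalIntegral_comp_comm i2).symm
    rw [h3, ← sub_eq_iff_eq_add', ← intervalIntegral.integral_sub (i1 _ (add_nonneg ht hr))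
      (i1 t ht)]
    refine intervalIntegral.integral_congr ?_
    intro s hs
    rw [uIcc_of_le hh] at hs
    have hs1 := hs.2
    simp only [map_sub]
    rw [M.TS t _ ht (by linarith), M.TS t _ ht (by linarith)]
    have e1 : t + (h + r - s) = h + (t + r) - s := by ring
    have e2 : t + (h + 0 - s) = h + t - s := by ring
    rw [e1, e2]; abel
  have d0 := hder 0 le_rfl
  rw [M.SD_zero hfh, add_zero, sub_zero] at d0
  have d1 : HasDerivWithinAt (fun r => G t + M.T t (G r - G 0)) (M.T t (M.SD f h)) (Ici 0) 0 := by
    have : HasDerivWithinAt (fun r => (M.T t).restrictScalars ℝ (G r - G 0))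
        ((M.T t).restrictScalars ℝ (M.SD f h)) (Ici 0) 0 :=
      ((M.T t).restrictScalars ℝ).hasFDerivAt.comp_hasDerivWithinAt 0 (d0.sub_const (G 0))
    exact this.const_add (G t)
  have d2 : HasDerivWithinAt (fun r => G (t + r))
      (M.SD f (h + t) - M.SD (fun s => f (h + s)) t) (Ici 0) 0 := by
    have h2 : HasDerivWithinAt (fun u : ℝ => t + u) 1 (Ici 0) 0 :=
      (hasDerivWithinAt_id 0 _).const_add t
    have h1 : HasDerivWithinAt G (M.SD f (h + t) - M.SD (fun s => f (h + s)) t) (Ici 0) (t + 0) := by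
      rw [add_zero]; exact hder t ht
    have h3 := HasDerivWithinAt.scomp 0 h1 h2 (fun s hs => add_nonneg ht hs)
    rw [one_smul] at h3
    exact h3
  have d3 := d1.congr_of_mem hGG self_mem_Ici
  have := (uniqueDiffOn_Ici (0:ℝ) 0 self_mem_Ici).eq_deriv _ d2 d3
  exact sub_eq_iff_eq_add.1 this

/-! ### The operator-valued convolution -/

theorem SDop_le {V : ℝ → (X₀ →L[ℂ] X)} (hV : SCont V) {t C : ℝ} (ht : 0 ≤ t) (hC0 : 0 ≤ C)
    (hC : ∀ s ∈ Icc (0:ℝ) t, ‖V s‖ ≤ C) : ‖M.SDop V t‖ ≤ M.δ t * C := by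
  refine ContinuousLinearMap.opNorm_le_bound _ (mul_nonneg (M.δ_nonneg t ht) hC0) ?_
  intro x
  rw [M.SDop_apply V hV, mul_assoc]
  exact M.SD_le (hV x) ht (fun s hs => (V s).le_of_opNorm_le (hC s hs) x)

theorem SDop_SCont {V : ℝ → (X₀ →L[ℂ] X)} (hV : SCont V) : SCont (M.SDop V) := by
  intro x
  have := M.SD_cont _ (hV x)
  refine this.congr ?_
  intro t _
  exact M.SDop_apply V hV t x

theorem SDop_zero {V : ℝ → (X₀ →L[ℂ] X)} (hV : SCont V) : M.SDop V 0 = 0 := by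
  ext x
  rw [M.SDop_apply V hV, M.SD_zero (hV x)]
  simp

theorem SDop_sub {V W : ℝ → (X₀ →L[ℂ] X)} (hV : SCont V) (hW : SCont W) {t : ℝ} (ht : 0 ≤ t) :
    M.SDop (fun s => V s - W s) t = M.SDop V t - M.SDop W t := by
  refine ContinuousLinearMap.ext fun x => ?_
  rw [sub_apply, M.SDop_apply _ (hV.sub hW), M.SDop_apply _ hV,
    M.SDop_apply _ hW, ← M.SD_sub (hV x) (hW x) ht]
  rfl

theorem SDop_comp {V : ℝ → (X₀ →L[ℂ] X)} (hV : SCont V) (K : X₀ →L[ℂ] X₀) (t : ℝ) :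
    M.SDop (fun s => (V s).comp K) t = (M.SDop V t).comp K := by
  refine ContinuousLinearMap.ext fun x => ?_
  rw [ContinuousLinearMap.comp_apply, M.SDop_apply _ (hV.comp_clm K), M.SDop_apply _ hV]
  rfl

theorem SDop_shift {V : ℝ → (X₀ →L[ℂ] X)} (hV : SCont V) {t h : ℝ} (ht : 0 ≤ t) (hh : 0 ≤ h) :
    M.SDop V (h + t) = (M.T t).comp (M.SDop V h) + M.SDop (fun s => V (h + s)) t := by
  refine ContinuousLinearMap.ext fun x => ?_
  rw [add_apply, ContinuousLinearMap.comp_apply,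
    M.SDop_apply _ (hV.shift hh), M.SDop_apply _ hV, M.SDop_apply _ hV]
  exact M.SD_shift (hV x) ht hh

theorem δ_le {s t : ℝ} (hs : 0 ≤ s) (h : s ≤ t) : M.δ s ≤ M.δ t :=
  M.δ_mono hs (hs.trans h) h

theorem SDop_NCont {V : ℝ → (X₀ →L[ℂ] X)} (hV : SCont V) (hN : NCont V) : NCont (M.SDop V) := by
  have := M.complete
  intro a b η ha hη
  rcases lt_or_ge b 0 with hb | hb
  · exact ⟨1, one_pos, fun h _ t ht => absurd (ht.1.trans ht.2) (by linarith)⟩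
  have hT : SCont M.T := M.T_cont
  obtain ⟨C, hC1, hC⟩ := hT.bdd b
  obtain ⟨D, hD1, hD⟩ := hV.bdd (b + 1)
  obtain ⟨ε, hε, hε1, hδε⟩ := M.exists_δ_le (η := η / (6 * C * D)) (a := min a 1)
    (by positivity) (by positivity)
  have hεa := hε1.trans (min_le_left _ _)
  have hε1 := hε1.trans (min_le_right _ _)
  have hb' := M.δ_nonneg b hb
  obtain ⟨h₀, hh₀, hN⟩ := hN ε b (η / (3 * (M.δ b + 1))) hε (by positivity)
  refine ⟨min h₀ ε, by positivity, ?_⟩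
  intro h hh t ht
  have hh0 := hh.1
  have hh1 := hh.2.trans (min_le_left _ _)
  have hh2 := hh.2.trans (min_le_right _ _)
  have ht0 : 0 ≤ t := ha.le.trans ht.1
  have hεt : ε ≤ t := hεa.trans ht.1
  have htb := ht.2
  have hbound : ∀ s ∈ Icc (0:ℝ) b, ‖V (h + s) - V s‖ ≤ 2 * D := by
    intro s hs
    have h1 := hD (h + s) ⟨by linarith [hs.1], by linarith [hs.2]⟩
    have h2 := hD s ⟨by linarith [hs.1], by linarith [hs.2]⟩
    linarith [norm_sub_le (V (h + s)) (V s)]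
  have hW : SCont (fun s => V (h + s) - V s) := (hV.shift hh0).sub hV
  have e1 : M.SDop V (h + t) - M.SDop V t =
      (M.T t).comp (M.SDop V h) + ((M.T (t - ε)).comp (M.SDop (fun s => V (h + s) - V s) ε)
        + M.SDop (fun s => V (h + (ε + s)) - V (ε + s)) (t - ε)) := by
    have h1 := M.SDop_shift hW (t := t - ε) (by linarith) hε.le
    rw [add_sub_cancel, M.SDop_sub (hV.shift hh0) hV ht0] at h1
    rw [← h1, M.SDop_shift hV ht0 hh0]
    abel
  have hCD : C * (η / (6 * C * D) * (2 * D)) = η / 3 := by field_simp; ring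
  have b1 : ‖(M.T t).comp (M.SDop V h)‖ ≤ η / 3 := by
    refine (ContinuousLinearMap.opNorm_comp_le _ _).trans ?_
    rw [← hCD]
    have h1 : ‖M.SDop V h‖ ≤ M.δ h * (2 * D) := M.SDop_le hV hh0 (by linarith) (fun s hs =>
      (hD s ⟨hs.1, by linarith [hs.2]⟩).trans (by linarith))
    have h2 := (M.δ_le hh0 hh2).trans hδε
    have h3 := hC t ⟨ht0, htb⟩
    gcongr
    refine h1.trans ?_
    gcongr
  have b2 : ‖(M.T (t - ε)).comp (M.SDop (fun s => V (h + s) - V s) ε)‖ ≤ η / 3 := by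
    refine (ContinuousLinearMap.opNorm_comp_le _ _).trans ?_
    rw [← hCD]
    have h1 := M.SDop_le hW hε.le (by linarith) (fun s hs =>
      hbound s ⟨hs.1, by linarith [hs.2]⟩)
    have h3 := hC (t - ε) ⟨by linarith, by linarith⟩
    gcongr
    refine h1.trans ?_
    gcongr
  have b3 : ‖M.SDop (fun s => V (h + (ε + s)) - V (ε + s)) (t - ε)‖ ≤ η / 3 := by
    have h1 := M.SDop_le (hW.shift hε.le) (t := t - ε) (C := η / (3 * (M.δ b + 1)))
      (by linarith) (by positivity)
      (fun s hs => hN h ⟨hh0, hh1⟩ (ε + s) ⟨by linarith [hs.1], by linarith [hs.2]⟩)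
    refine h1.trans ?_
    have h2 := M.δ_le (s := t - ε) (t := b) (by linarith) (by linarith)
    have h4 : (M.δ b + 1) * (η / (3 * (M.δ b + 1))) = η / 3 := by field_simp
    rw [← h4]
    gcongr
    linarith
  rw [e1]
  refine (norm_add_le _ _).trans ?_
  refine (add_le_add b1 ((norm_add_le _ _).trans (add_le_add b2 b3))).trans ?_
  linarith

/-- `(T(h) - 1) K → 0` in norm. -/
def RC : Set (X₀ →L[ℂ] X₀) := {K | Tendsto (fun h => (M.T h).comp K) (𝓝[>] 0) (𝓝 K)}

theorem δ_mul_lim (C : ℝ) : Tendsto (fun h => M.δ h * C) (𝓝[>] 0) (𝓝 0) := by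
  simpa using M.δ_lim.mul_const C

theorem SDop_mem_RC {V : ℝ → (X₀ →L[ℂ] X)} (hV : SCont V) (hN : NCont V) {t : ℝ} (ht : 0 < t) :
    M.SDop V t ∈ M.RC := by
  have := M.complete
  have hc : ContinuousWithinAt (M.SDop V) (Ioi 0) t := (M.SDop_NCont hV hN).continuousOn t ht
  have h1 : Tendsto (fun h => M.SDop V (t + h)) (𝓝[>] 0) (𝓝 (M.SDop V t)) := by
    refine hc.tendsto.comp ?_
    refine tendsto_nhdsWithin_iff.2 ⟨?_, ?_⟩
    · have : Tendsto (fun h : ℝ => t + h) (𝓝 0) (𝓝 (t + 0)) := tendsto_const_nhds.add tendsto_id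
      rw [add_zero] at this
      exact this.mono_left nhdsWithin_le_nhds
    · filter_upwards [self_mem_nhdsWithin] with h hh
      exact add_pos ht hh
  have h2 : Tendsto (fun h => M.SDop (fun s => V (t + s)) h) (𝓝[>] 0) (𝓝 0) := by
    obtain ⟨C, hC1, hC⟩ := (hV.shift ht.le).bdd 1
    refine squeeze_zero_norm' (E := X₀ →L[ℂ] X₀) (a := fun h => M.δ h * C) ?_ (M.δ_mul_lim C)
    filter_upwards [Ioc_mem_nhdsGT (one_pos : (0:ℝ) < 1)] with h hh
    exact M.SDop_le (hV.shift ht.le) hh.1.le (by linarith)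
      (fun s hs => hC s ⟨hs.1, hs.2.trans hh.2⟩)
  have h3 := h1.sub h2
  rw [sub_zero] at h3
  refine h3.congr' ?_
  filter_upwards [self_mem_nhdsWithin] with h hh
  rw [M.SDop_shift hV (le_of_lt hh) ht.le]
  abel

theorem RC_closed : IsClosed M.RC := by
  have := M.complete
  have hT : SCont M.T := M.T_cont
  obtain ⟨C, hC1, hC⟩ := hT.bdd 1
  refine isClosed_of_closure_subset fun K hK => ?_
  have hK := (Metric.mem_closure_iff (α := X₀ →L[ℂ] X₀)).1 hK
  refine (tendsto_norm_iff (E := X₀ →L[ℂ] X₀)).2 ?_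
  intro ε hε
  obtain ⟨A, hA, hKA⟩ := hK (ε / (2 * (C + 1))) (by positivity)
  have hA := (tendsto_norm_iff (E := X₀ →L[ℂ] X₀)).1 hA
  filter_upwards [hA (ε / 2) (by positivity), Ioc_mem_nhdsGT (one_pos : (0:ℝ) < 1)] with h h1 h2
  have hKA : ‖K - A‖ < ε / (2 * (C + 1)) := by
    rw [← dist_eq_norm (E := X₀ →L[ℂ] X₀)]
    exact hKA
  have e : (M.T h).comp K - K = (M.T h).comp (K - A) + (((M.T h).comp A - A) - (K - A)) := by
    rw [ContinuousLinearMap.comp_sub]; abel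
  rw [e]
  have h3 : ‖(M.T h).comp (K - A)‖ ≤ C * ‖K - A‖ := by
    refine (ContinuousLinearMap.opNorm_comp_le _ _).trans ?_
    gcongr
    exact hC h ⟨h2.1.le, h2.2⟩
  have h4 := norm_add_le ((M.T h).comp (K - A)) (((M.T h).comp A - A) - (K - A))
  have h5 := norm_sub_le ((M.T h).comp A - A) (K - A)
  have h6 : (C + 1) * ‖K - A‖ < (C + 1) * (ε / (2 * (C + 1))) := by gcongr
  have h7 : (C + 1) * (ε / (2 * (C + 1))) = ε / 2 := by field_simp
  linarith

theorem RC_T_comp {K : X₀ →L[ℂ] X₀} (hK : K ∈ M.RC) {t : ℝ} (ht : 0 ≤ t) :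
    (M.T t).comp K ∈ M.RC := by
  have h1 : Tendsto (fun h => (M.T t).comp ((M.T h).comp K)) (𝓝[>] 0) (𝓝 ((M.T t).comp K)) :=
    ((continuous_const.clm_comp continuous_id).tendsto K).comp hK
  refine h1.congr' ?_
  filter_upwards [self_mem_nhdsWithin] with h hh
  have hh : (0:ℝ) ≤ h := le_of_lt hh
  rw [← ContinuousLinearMap.comp_assoc, ← M.T_add t h ht hh, add_comm, M.T_add h t hh ht,
    ContinuousLinearMap.comp_assoc]

theorem RC_comp {K : X₀ →L[ℂ] X₀} (hK : K ∈ M.RC) (A : X₀ →L[ℂ] X₀) :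
    K.comp A ∈ M.RC := by
  have h1 : Tendsto (fun h => ((M.T h).comp K).comp A) (𝓝[>] 0) (𝓝 (K.comp A)) :=
    ((continuous_id.clm_comp continuous_const).tendsto K).comp hK
  exact h1

theorem RC_add {K A : X₀ →L[ℂ] X₀} (hK : K ∈ M.RC) (hA : A ∈ M.RC) : K + A ∈ M.RC := by
  have h1 := Tendsto.add hK hA
  simp only [← ContinuousLinearMap.comp_add] at h1
  exact h1

theorem RC_zero : (0 : X₀ →L[ℂ] X₀) ∈ M.RC := by
  change Tendsto _ _ _
  simp

/-! ### Compactness -/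

theorem exists_conv {φ : ℝ → ℂ} (hφ : ContinuousOn φ (Ici 0)) {t : ℝ} (ht : 0 ≤ t) :
    ∃ Q : X →L[ℂ] X₀, ∀ y, Q y = M.SD (fun s => φ s • y) t := by
  obtain ⟨C, hC⟩ := isCompact_Icc.exists_bound_of_continuousOn
    (hφ.mono (Icc_subset_Ici_self : Icc (0:ℝ) t ⊆ Ici 0))
  have hc : ∀ y : X, ContinuousOn (fun s => φ s • y) (Ici 0) := fun y => hφ.smul continuousOn_const
  let Q : X →ₗ[ℂ] X₀ :=
    { toFun := fun y => M.SD (fun s => φ s • y) t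
      map_add' := by
        intro y z
        simp only [smul_add]
        exact M.SD_add (hc y) (hc z) ht
      map_smul' := by
        intro c y
        have := M.SD_smul (hc y) c ht
        simp only [RingHom.id_apply, ← this]
        congr 1
        funext s
        exact smul_comm _ _ _ }
  refine ⟨Q.mkContinuous (M.δ t * C) ?_, fun y => rfl⟩
  intro y
  rw [mul_assoc]
  refine M.SD_le (hc y) ht ?_
  intro s hs
  rw [norm_smul]
  gcongr
  exact hC s hs

theorem SD_sum {ι : Type*} (A : Finset ι) (f : ι → ℝ → X) (hf : ∀ i, ContinuousOn (f i) (Ici 0))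
    {t : ℝ} (ht : 0 ≤ t) : M.SD (fun s => ∑ i ∈ A, f i s) t = ∑ i ∈ A, M.SD (f i) t := by
  classical
  induction A using Finset.induction_on with
  | empty =>
    have := M.SD_smul (f := fun _ => (0:X)) continuousOn_const (0:ℂ) ht
    simpa using this
  | insert a A ha ih =>
    simp only [Finset.sum_insert ha]
    rw [← ih]
    exact M.SD_add (hf a) (continuousOn_finsetSum A (fun i _ => hf i)) ht

theorem isClosed_comp (M : MRSetting X X₀) : IsClosed {K : X₀ →L[ℂ] X₀ | IsCompactOperator ⇑K} := by
  have := M.complete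
  exact isClosed_setOfPred_isCompactOperator

theorem SDop_compact_aux {V : ℝ → (X₀ →L[ℂ] X)} (hV : SCont V) {t : ℝ} (ht : 0 < t)
    (hc : ContinuousOn V (Icc 0 t)) (hK : ∀ s ∈ Icc 0 t, IsCompactOperator ⇑(V s)) :
    IsCompactOperator ⇑(M.SDop V t) := by
  have hmem : ∀ u : unitInterval, t * (u:ℝ) ∈ Icc 0 t := fun u =>
    ⟨mul_nonneg ht.le u.2.1, mul_le_of_le_one_right ht.le u.2.2⟩
  let f : unitInterval → (X₀ →L[ℂ] X) := fun u => V (t * (u:ℝ))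
  have hf : Continuous f := hc.comp_continuous (by fun_prop) hmem
  refine mem_closed_of_norm (E := X₀ →L[ℂ] X₀) M.isClosed_comp ?_
  intro ε hε
  have hδ := M.δ_nonneg t ht.le
  obtain ⟨n, hn⟩ := bernstein_approx (E := X₀ →L[ℂ] X) hf (ε := ε / (M.δ t + 1)) (by positivity)
  let p : ℝ → unitInterval := fun s => projIcc 0 1 zero_le_one (s / t)
  have hp : Continuous p := continuous_projIcc.comp (by fun_prop)
  have hb : ∀ k : ℕ, ContinuousOn (fun s => ((bernstein n k (p s) : ℝ) : ℂ)) (Ici 0) := by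
    intro k
    exact (Complex.continuous_ofReal.comp ((map_continuous _).comp hp)).continuousOn
  let W : ℝ → (X₀ →L[ℂ] X) := fun s =>
    ∑ k : Fin (n + 1), ((bernstein n k (p s) : ℝ) : ℂ) • f (bernstein.z k)
  have hWx : ∀ x s, W s x = ∑ k : Fin (n + 1),
      ((bernstein n k (p s) : ℝ) : ℂ) • (f (bernstein.z k) x) := by
    intro x s
    simp only [W, sum_apply]
    rfl
  have hW : SCont W := by
    intro x
    simp only [hWx]
    exact continuousOn_finsetSum _ (fun k _ => (hb k).smul continuousOn_const)
  refine ⟨M.SDop W t, ?_, ?_⟩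
  · choose Q hQ using fun k : ℕ => M.exists_conv (hb k) ht.le
    have e : M.SDop W t = ∑ k : Fin (n + 1), (Q k).comp (f (bernstein.z k)) := by
      refine ContinuousLinearMap.ext fun x => ?_
      rw [M.SDop_apply W hW]
      simp only [hWx]
      rw [M.SD_sum Finset.univ (fun (k : Fin (n+1)) s => ((bernstein n k (p s) : ℝ) : ℂ) •
        (f (bernstein.z k) x)) (fun k => (hb k).smul continuousOn_const) ht.le, sum_apply]
      refine Finset.sum_congr rfl fun k _ => ?_
      rw [ContinuousLinearMap.comp_apply, hQ]
    have : M.SDop W t ∈ compactOperator (RingHom.id ℂ) X₀ X₀ := by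
      rw [e]
      refine Submodule.sum_mem _ fun k _ => ?_
      exact (hK _ (hmem _)).clm_comp (Q k)
    exact this
  · rw [← M.SDop_sub hV hW ht.le]
    have h2 : ‖M.SDop (fun s => V s - W s) t‖ ≤ M.δ t * (ε / (M.δ t + 1)) := by
      refine M.SDop_le (hV.sub hW) ht.le (by positivity) ?_
      intro s hs
      have h3 : V s = f (p s) := by
        have : t * (p s : ℝ) = s := by
          simp only [p]
          rw [projIcc_of_mem zero_le_one ⟨div_nonneg hs.1 ht.le, (div_le_one ht).2 hs.2⟩]
          field_simp
        simp only [f, this]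
      rw [h3]
      exact hn (p s)
    refine h2.trans_lt ?_
    rw [mul_div_assoc', div_lt_iff₀ (by positivity)]
    nlinarith

theorem SDop_compact {V : ℝ → (X₀ →L[ℂ] X)} (hV : SCont V) (hN : NCont V)
    (hK : ∀ s, 0 < s → IsCompactOperator ⇑(V s)) {t : ℝ} (ht : 0 < t) :
    IsCompactOperator ⇑(M.SDop V t) := by
  have := M.complete
  have hT : SCont M.T := M.T_cont
  obtain ⟨C, hC1, hC⟩ := hT.bdd t
  obtain ⟨D, hD1, hD⟩ := hV.bdd t
  have key : M.SDop V t ∈ {K : X₀ →L[ℂ] X₀ | IsCompactOperator ⇑K} := by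
    refine mem_closed_of_norm (E := X₀ →L[ℂ] X₀) M.isClosed_comp ?_
    intro η hη
    obtain ⟨ε, hε, hεt, hδε⟩ := M.exists_δ_le (η := η / (2 * C * D)) (a := t / 2)
      (by positivity) (by positivity)
    refine ⟨M.SDop (fun s => V (ε + s)) (t - ε), ?_, ?_⟩
    · refine M.SDop_compact_aux (hV.shift hε.le) (by linarith) ?_ ?_
      · exact hN.continuousOn.comp (by fun_prop) (fun s hs => add_pos_of_pos_of_nonneg hε hs.1)
      · exact fun s hs => hK _ (add_pos_of_pos_of_nonneg hε hs.1)
    · have h1 := M.SDop_shift hV (t := t - ε) (by linarith) hε.le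
      rw [add_sub_cancel] at h1
      rw [h1, add_sub_cancel_right]
      have h2 : ‖(M.T (t - ε)).comp (M.SDop V ε)‖ ≤ C * (η / (2 * C * D) * D) := by
        refine (ContinuousLinearMap.opNorm_comp_le _ _).trans ?_
        have h1 := M.SDop_le hV hε.le (by linarith) (fun s hs =>
          hD s ⟨hs.1, by linarith [hs.2]⟩)
        have h3 := hC (t - ε) ⟨by linarith, by linarith⟩
        gcongr
        refine h1.trans ?_
        gcongr
      have h3 : C * (η / (2 * C * D) * D) = η / 2 := by field_simp
      linarith
  exact key

/-! ### The perturbed semigroup -/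

/-- Picard iterates. -/
def picard (L : X₀ →L[ℂ] X) : ℕ → ℝ → (X₀ →L[ℂ] X₀)
  | 0 => M.T
  | n + 1 => fun t => M.T t + M.SDop (fun s => L.comp (picard L n s)) t

theorem picard_SCont (L : X₀ →L[ℂ] X) (n : ℕ) : SCont (M.picard L n) := by
  induction n with
  | zero => exact M.T_cont
  | succ n ih => exact SCont.add M.T_cont (M.SDop_SCont (ih.clm_comp L))

section

variable (L : X₀ →L[ℂ] X) (R : ℝ → (X₀ →L[ℂ] X₀))

theorem contract {τ : ℝ} (hδ : M.δ τ ≤ 1 / (2 * (‖L‖ + 1)))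
    {E : ℝ → (X₀ →L[ℂ] X₀)} (hE : SCont E) {C : ℝ} (hC0 : 0 ≤ C)
    (hC : ∀ t ∈ Icc 0 τ, ‖E t‖ ≤ C) :
    ∀ t ∈ Icc 0 τ, ‖M.SDop (fun s => L.comp (E s)) t‖ ≤ 1 / 2 * C := by
  intro t ht
  have h1 : ‖M.SDop (fun s => L.comp (E s)) t‖ ≤ M.δ t * (‖L‖ * C) := by
    refine M.SDop_le (hE.clm_comp L) ht.1 (by positivity) ?_
    intro s hs
    refine (ContinuousLinearMap.opNorm_comp_le _ _).trans ?_
    gcongr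
    exact hC s ⟨hs.1, hs.2.trans ht.2⟩
  have h2 : M.δ t ≤ 1 / (2 * (‖L‖ + 1)) := (M.δ_le ht.1 ht.2).trans hδ
  have h3 : 1 / (2 * (‖L‖ + 1)) * ((‖L‖ + 1) * C) = 1 / 2 * C := by
    have : ‖L‖ + 1 ≠ 0 := by positivity
    field_simp
  rw [← h3]
  refine h1.trans ?_
  gcongr
  linarith

theorem picard_lim (hRsc : SCont R) (hRfix : ∀ t ∈ Ici (0:ℝ), R t = M.T t + M.Bop L R t)
    {τ : ℝ} (hτ : 0 ≤ τ) (hδ : M.δ τ ≤ 1 / (2 * (‖L‖ + 1))) :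
    ∃ C : ℝ, 0 ≤ C ∧ ∀ n : ℕ, ∀ t ∈ Icc 0 τ, ‖R t - M.picard L n t‖ ≤ (1 / 2) ^ n * C := by
  have := M.complete
  obtain ⟨C, hC1, hC⟩ := (hRsc.sub (M.picard_SCont L 0)).bdd τ
  refine ⟨C, by linarith, ?_⟩
  intro n
  induction n with
  | zero => simpa using hC
  | succ n ih =>
    intro t ht
    have h1 := M.contract L hδ (hRsc.sub (M.picard_SCont L n)) (by positivity) ih t ht
    have e : R t - M.picard L (n + 1) t =
        M.SDop (fun s => L.comp (R s - M.picard L n s)) t := by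
      simp only [ContinuousLinearMap.comp_sub]
      rw [M.SDop_sub (hRsc.clm_comp L) ((M.picard_SCont L n).clm_comp L) ht.1, hRfix t ht.1]
      simp only [picard, Bop]
      abel
    rw [e, pow_succ]
    linarith

theorem R_add (hRsc : SCont R) (hRfix : ∀ t ∈ Ici (0:ℝ), R t = M.T t + M.Bop L R t)
    {τ : ℝ} (hδ : M.δ τ ≤ 1 / (2 * (‖L‖ + 1)))
    {t r : ℝ} (ht : t ∈ Icc 0 τ) (hr : 0 ≤ r) : R (r + t) = (R t).comp (R r) := by
  have := M.complete
  have hτ : 0 ≤ τ := ht.1.trans ht.2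
  let E : ℝ → (X₀ →L[ℂ] X₀) := fun t => R (r + t) - (R t).comp (R r)
  have hE : SCont E := (hRsc.shift hr).sub (hRsc.comp_clm (R r))
  have hLR := hRsc.clm_comp L
  have hfix : ∀ t, 0 ≤ t → E t = M.SDop (fun s => L.comp (E s)) t := by
    intro t ht
    simp only [E, ContinuousLinearMap.comp_sub]
    rw [M.SDop_sub ((hRsc.shift hr).clm_comp L) ((hRsc.comp_clm (R r)).clm_comp L) ht]
    simp only [← ContinuousLinearMap.comp_assoc]
    rw [M.SDop_comp hLR (R r) t, hRfix (r + t) (add_nonneg hr ht), hRfix t ht]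
    simp only [Bop]
    rw [M.SDop_shift hLR ht hr, add_comm r t, M.T_add t r ht hr]
    have h1 := hRfix r hr
    simp only [Bop] at h1
    have h2 : (M.T t).comp (R r) = (M.T t).comp (M.T r) +
      (M.T t).comp (M.SDop (fun s => L.comp (R s)) r) := by
      rw [h1, ContinuousLinearMap.comp_add]
    rw [ContinuousLinearMap.add_comp, h2]
    abel
  obtain ⟨C, hC1, hC⟩ := hE.bdd τ
  have hn : ∀ n : ℕ, ∀ t ∈ Icc 0 τ, ‖E t‖ ≤ (1 / 2) ^ n * C := by
    intro n
    induction n with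
    | zero => simpa using hC
    | succ n ih =>
      intro t ht
      have h1 := M.contract L hδ hE (by positivity) ih t ht
      rw [hfix t ht.1, pow_succ]
      linarith
  have hlim : Tendsto (fun n : ℕ => (1 / 2 : ℝ) ^ n * C) atTop (𝓝 0) := by
    simpa using (tendsto_pow_atTop_nhds_zero_of_lt_one (r := (1/2:ℝ)) (by norm_num)
      (by norm_num)).mul_const C
  have h0 : ‖E t‖ ≤ 0 := ge_of_tendsto' hlim (fun n => hn n t ht)
  exact sub_eq_zero.1 (norm_le_zero_iff.1 h0)

theorem Bop_mem (hRsc : SCont R) (hRfix : ∀ t ∈ Ici (0:ℝ), R t = M.T t + M.Bop L R t)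
    (P : Set (X₀ →L[ℂ] X₀)) (hPc : IsClosed P) (hP0 : 0 ∈ P)
    (hPadd : ∀ A ∈ P, ∀ B ∈ P, A + B ∈ P)
    (hPT : ∀ A ∈ P, ∀ t : ℝ, 0 ≤ t → (M.T t).comp A ∈ P)
    (hPr : ∀ A ∈ P, ∀ B : X₀ →L[ℂ] X₀, A.comp B ∈ P)
    (good : (ℝ → (X₀ →L[ℂ] X)) → Prop)
    (hgT : good (fun s => L.comp (M.T s)))
    (hgadd : ∀ V W, good V → good W → good (fun s => V s + W s))
    (hgB : ∀ V, SCont V → good V → good (fun s => L.comp (M.SDop V s)))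
    (hgP : ∀ V, SCont V → good V → ∀ t : ℝ, 0 < t → M.SDop V t ∈ P) :
    ∀ t : ℝ, 0 ≤ t → M.Bop L R t ∈ P := by
  have hg : ∀ n, good (fun s => L.comp (M.picard L n s)) := by
    intro n
    induction n with
    | zero => exact hgT
    | succ n ih =>
      have := hgadd _ _ hgT (hgB _ ((M.picard_SCont L n).clm_comp L) ih)
      simpa only [picard, ContinuousLinearMap.comp_add] using this
  obtain ⟨τ, hτ, -, hδ⟩ := M.exists_δ_le (η := 1 / (2 * (‖L‖ + 1))) (a := 1) (by positivity)
    one_pos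
  obtain ⟨C, hC0, hC⟩ := M.picard_lim L R hRsc hRfix hτ.le hδ
  have hlim : Tendsto (fun n : ℕ => 1 / 2 * ((1 / 2 : ℝ) ^ n * C)) atTop (𝓝 0) := by
    have := ((tendsto_pow_atTop_nhds_zero_of_lt_one (r := (1/2:ℝ)) (by norm_num)
      (by norm_num)).mul_const C).const_mul (1/2)
    rwa [zero_mul, mul_zero] at this
  have hsmall : ∀ t ∈ Icc 0 τ, M.Bop L R t ∈ P := by
    intro t ht
    rcases ht.1.eq_or_lt with h0 | h0
    · rw [← h0, Bop, M.SDop_zero (hRsc.clm_comp L)]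
      exact hP0
    refine mem_closed_of_norm (E := X₀ →L[ℂ] X₀) hPc ?_
    intro ε hε
    obtain ⟨n, hn⟩ := (hlim.eventually_lt_const hε).exists
    refine ⟨M.SDop (fun s => L.comp (M.picard L n s)) t,
      hgP _ ((M.picard_SCont L n).clm_comp L) (hg n) t h0, lt_of_le_of_lt ?_ hn⟩
    rw [Bop, ← M.SDop_sub (hRsc.clm_comp L) ((M.picard_SCont L n).clm_comp L) ht.1]
    simp only [← ContinuousLinearMap.comp_sub]
    exact M.contract L hδ (hRsc.sub (M.picard_SCont L n)) (by positivity) (hC n) t ht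
  have hall : ∀ n : ℕ, ∀ t : ℝ, 0 ≤ t → t ≤ n * τ → M.Bop L R t ∈ P := by
    intro n
    induction n with
    | zero =>
      intro t ht htn
      simp only [Nat.cast_zero, zero_mul] at htn
      exact hsmall t ⟨ht, by linarith⟩
    | succ n ih =>
      intro t ht htn
      rcases le_total t τ with h | h
      · exact hsmall t ⟨ht, h⟩
      push_cast at htn
      have hr : 0 ≤ t - τ := by linarith
      have hA := hsmall τ ⟨hτ.le, le_rfl⟩
      have hB := ih (t - τ) hr (by linarith)
      have e0 : ∀ s, 0 ≤ s → M.Bop L R s = R s - M.T s := by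
        intro s hs
        rw [hRfix s hs]
        abel
      have e : M.Bop L R t =
          (M.Bop L R τ).comp (R (t - τ)) + (M.T τ).comp (M.Bop L R (t - τ)) := by
        have h1 := M.R_add L R hRsc hRfix hδ (t := τ) ⟨hτ.le, le_rfl⟩ hr
        have h2 := M.T_add τ (t - τ) hτ.le hr
        rw [sub_add_cancel] at h1
        rw [add_sub_cancel] at h2
        rw [e0 t ht, e0 τ hτ.le, e0 _ hr, h1, h2, ContinuousLinearMap.sub_comp,
          ContinuousLinearMap.comp_sub]
        abel
      rw [e]
      exact hPadd _ (hPr _ hA _) _ (hPT _ hB τ hτ.le)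
  intro t ht
  obtain ⟨n, hn⟩ := exists_nat_ge (t / τ)
  exact hall n t ht ((div_le_iff₀ hτ).1 hn)

end


end MRSetting

theorem seqOp_norm_le (W : X₀ →L[ℂ] X₀) (x : BoundedContinuousFunction ℕ X₀) :
    ‖seqOp W x‖ ≤ ‖W‖ * ‖x‖ := by
  refine (BoundedContinuousFunction.norm_le (by positivity)).2 fun n => ?_
  exact (W.le_opNorm _).trans (by gcongr; exact x.norm_coe_le_norm n)

theorem seqOp_add (W V : X₀ →L[ℂ] X₀) (x : BoundedContinuousFunction ℕ X₀) :
    seqOp (W + V) x = seqOp W x + seqOp V x := by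
  ext n; rfl

theorem seqOp_sub (W V : X₀ →L[ℂ] X₀) (x : BoundedContinuousFunction ℕ X₀) :
    seqOp (W - V) x = seqOp W x - seqOp V x := by
  ext n; rfl

theorem seqOp_comp (W V : X₀ →L[ℂ] X₀) (x : BoundedContinuousFunction ℕ X₀) :
    seqOp (W.comp V) x = seqOp W (seqOp V x) := by
  ext n; rfl

theorem mem_critSub (W : ℝ → (X₀ →L[ℂ] X₀)) (x : BoundedContinuousFunction ℕ X₀) :
    x ∈ critSub W ↔ Tendsto (fun t : ℝ => seqOp (W t) x) (𝓝[>] 0) (𝓝 x) := Iff.rfl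

theorem critSub_of_RC (M : MRSetting X X₀) {K : X₀ →L[ℂ] X₀} (hK : K ∈ M.RC)
    (x : BoundedContinuousFunction ℕ X₀) : seqOp K x ∈ critSub M.T := by
  have h1 := (tendsto_norm_iff (E := X₀ →L[ℂ] X₀)).1 hK
  rw [mem_critSub]
  refine (tendsto_norm_iff (E := BoundedContinuousFunction ℕ X₀)).2 fun ε hε => ?_
  filter_upwards [h1 (ε / (‖x‖ + 1)) (by positivity)] with h hh
  rw [← seqOp_comp, ← seqOp_sub]
  refine (seqOp_norm_le _ _).trans_lt ?_
  calc _ ≤ ‖(M.T h).comp K - K‖ * (‖x‖ + 1) := by gcongr; linarith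
    _ < ε / (‖x‖ + 1) * (‖x‖ + 1) := by gcongr
    _ = ε := by field_simp

theorem critSub_T_inv (M : MRSetting X X₀) {t : ℝ} (ht : 0 ≤ t)
    {x : BoundedContinuousFunction ℕ X₀} (hx : x ∈ critSub M.T) :
    seqOp (M.T t) x ∈ critSub M.T := by
  rw [mem_critSub] at hx ⊢
  refine (((seqOp (M.T t)).continuous.tendsto x).comp hx).congr' ?_
  filter_upwards [self_mem_nhdsWithin] with h hh
  have hh : (0:ℝ) ≤ h := le_of_lt hh
  simp only [Function.comp]
  rw [← seqOp_comp, ← seqOp_comp, ← M.T_add t h ht hh, ← M.T_add h t hh ht, add_comm]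

theorem critSub_eq (M : MRSetting X X₀) (L : X₀ →L[ℂ] X)
    (R : ℝ → (X₀ →L[ℂ] X₀)) (hRsc : SCont R)
    (hRfix : ∀ t ∈ Ici (0:ℝ), R t = M.T t + M.Bop L R t) : critSub R = critSub M.T := by
  have := M.complete
  have hLR := hRsc.clm_comp L
  obtain ⟨C, hC1, hC⟩ := hLR.bdd 1
  ext x
  have hlim : Tendsto (fun t => seqOp (M.Bop L R t) x) (𝓝[>] 0) (𝓝 0) := by
    refine squeeze_zero_norm' ?_ (M.δ_mul_lim (C * ‖x‖))
    filter_upwards [Ioc_mem_nhdsGT (one_pos : (0:ℝ) < 1)] with h hh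
    refine (seqOp_norm_le _ _).trans ?_
    rw [← mul_assoc]
    refine mul_le_mul_of_nonneg_right ?_ (norm_nonneg _)
    exact M.SDop_le hLR hh.1.le (by linarith)
      (fun s hs => hC s ⟨hs.1, hs.2.trans hh.2⟩)
  have e : ∀ᶠ t in 𝓝[>] (0:ℝ), seqOp (R t) x = seqOp (M.T t) x + seqOp (M.Bop L R t) x := by
    filter_upwards [self_mem_nhdsWithin] with h hh
    have hh : h ∈ Ici (0:ℝ) := Ioi_subset_Ici_self hh
    rw [← seqOp_add, ← hRfix h hh]
  rw [mem_critSub, mem_critSub]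
  constructor
  · intro h
    have := h.sub hlim
    rw [sub_zero] at this
    refine this.congr' ?_
    filter_upwards [e] with t ht
    rw [ht, add_sub_cancel_right]
  · intro h
    have := h.add hlim
    rw [add_zero] at this
    refine this.congr' ?_
    filter_upwards [e] with t ht
    rw [ht]

/-- stability of the critical (resp. essential) growth bound when `L ∘ T₀` is
norm continuous (resp. norm continuous and compact) on `(0,∞)`. -/
theorem growth_bound_LT (M : MRSetting X X₀) (L : X₀ →L[ℂ] X)
    (R : ℝ → (X₀ →L[ℂ] X₀))
    (hRsc : ∀ x : X₀, ContinuousOn (fun t => R t x) (Ici 0))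
    (hRfix : ∀ t ∈ Ici (0:ℝ), R t = M.T t + M.Bop L R t) :
    -- (a)
    (ContinuousOn (fun t => L.comp (M.T t)) (Ioi 0) →
      critSub R = critSub M.T ∧
      (∀ t : ℝ, 0 ≤ t → ∀ x ∈ critSub M.T, seqOp (M.T t) x ∈ critSub M.T) ∧
      (∀ t : ℝ, 0 ≤ t → ∀ x ∈ critSub M.T, seqOp (R t) x ∈ critSub M.T) ∧
      omegaCrit R = omegaCrit M.T) ∧
    -- (b)
    (ContinuousOn (fun t => L.comp (M.T t)) (Ioi 0) →
      (∀ t : ℝ, 0 < t → IsCompactOperator ⇑(L.comp (M.T t))) →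
      omegaEss R = omegaEss M.T) := by
  have hR : SCont R := hRsc
  refine ⟨fun hN => ?_, fun hN hK => ?_⟩
  · have hB : ∀ t : ℝ, 0 ≤ t → M.Bop L R t ∈ M.RC :=
      M.Bop_mem L R hR hRfix M.RC M.RC_closed M.RC_zero
        (fun A hA B hB => M.RC_add hA hB) (fun A hA t ht => M.RC_T_comp hA ht)
        (fun A hA B => M.RC_comp hA B) NCont (NCont.of_continuousOn hN)
        (fun V W hV hW => hV.add hW) (fun V hV hg => (M.SDop_NCont hV hg).clm_comp L)
        (fun V hV hg t ht => M.SDop_mem_RC hV hg ht)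
    have e : ∀ t : ℝ, 0 ≤ t → ∀ x, seqOp (R t) x = seqOp (M.T t) x + seqOp (M.Bop L R t) x := by
      intro t ht x
      rw [← seqOp_add, ← hRfix t ht]
    have hc := critSub_eq M L R hR hRfix
    refine ⟨hc, fun t ht x hx => critSub_T_inv M ht hx, fun t ht x hx => ?_, ?_⟩
    · rw [e t ht]
      exact (critSub M.T).add_mem (critSub_T_inv M ht hx) (critSub_of_RC M (hB t ht) x)
    · unfold omegaCrit
      rw [hc]
      have : ∀ t : ℝ, 0 ≤ t → ∀ x, Metric.infDist (seqOp (R t) x)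
          (critSub M.T : Set (BoundedContinuousFunction ℕ X₀)) =
          Metric.infDist (seqOp (M.T t) x)
          (critSub M.T : Set (BoundedContinuousFunction ℕ X₀)) := by
        intro t ht x
        rw [e t ht]
        exact infDist_add_mem _ (fun a ha b hb => (critSub M.T).add_mem ha hb)
          (fun a ha => (critSub M.T).neg_mem ha) _ _ (critSub_of_RC M (hB t ht) x)
      congr 2
      ext w
      refine exists_congr fun C => and_congr_right fun _ => ?_
      refine forall_congr' fun t => forall_congr' fun ht => forall_congr' fun x => ?_
      rw [this t ht x]
  · have hB : ∀ t : ℝ, 0 ≤ t → M.Bop L R t ∈ {K : X₀ →L[ℂ] X₀ | IsCompactOperator ⇑K} :=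
      M.Bop_mem L R hR hRfix {K : X₀ →L[ℂ] X₀ | IsCompactOperator ⇑K} M.isClosed_comp
        isCompactOperator_zero
        (fun A hA B hB => IsCompactOperator.add hA hB)
        (fun A hA t ht => IsCompactOperator.clm_comp hA (M.T t))
        (fun A hA B => IsCompactOperator.comp_clm hA B)
        (fun V => NCont V ∧ ∀ s, 0 < s → IsCompactOperator ⇑(V s))
        ⟨NCont.of_continuousOn hN, hK⟩
        (fun V W hV hW => ⟨hV.1.add hW.1, fun s hs => IsCompactOperator.add (hV.2 s hs) (hW.2 s hs)⟩)
        (fun V hV hg => ⟨(M.SDop_NCont hV hg.1).clm_comp L,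
          fun s hs => IsCompactOperator.clm_comp (M.SDop_compact hV hg.1 hg.2 hs) L⟩)
        (fun V hV hg t ht => M.SDop_compact hV hg.1 hg.2 ht)
    have : ∀ t : ℝ, 0 ≤ t →
        Metric.infDist (R t) {K : X₀ →L[ℂ] X₀ | IsCompactOperator ⇑K} =
        Metric.infDist (M.T t) {K : X₀ →L[ℂ] X₀ | IsCompactOperator ⇑K} := by
      intro t ht
      have h := infDist_add_mem (E := X₀ →L[ℂ] X₀) {K : X₀ →L[ℂ] X₀ | IsCompactOperator ⇑K}
        (fun a ha b hb => by
          have : IsCompactOperator (⇑a + ⇑b) := IsCompactOperator.add ha hb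
          exact this)
        (fun a ha => by
          have : IsCompactOperator (-⇑a) := IsCompactOperator.neg ha
          exact this)
        (M.T t) _ (hB t ht)
      rw [← hRfix t ht] at h
      exact h
    unfold omegaEss
    congr 2
    ext w
    refine exists_congr fun C => and_congr_right fun _ => ?_
    refine forall_congr' fun t => forall_congr' fun ht => ?_
    rw [this t ht]

end
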